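/- arXiv:2205.15092 — 2 statements merged into one kernel-verified Lean document; each statement's English description precedes it below -/
import Mathlib

section
/- (Two-phase Korn–Poincaré inequality, Lemma 0 of the paper in the ball/annulus geometry.) Let R > 1 and set Ω⁻ := {x ∈ ℝ² : ‖x‖ < 1}, Γ := {x ∈ ℝ² : ‖x‖ = 1}, Ω⁺ := {x ∈ ℝ² : 1 < ‖x‖ < R}. There exists a constant C > 0 such that: for every u : ℝ² → ℝ² which is continuous on the closed ball {‖x‖ ≤ R}, vanishes at every point of the sphere {‖x‖ = R}, and is differentiable at every point of Ω⁺ ∪ Ω⁻ with Jacobian Du bounded on Ω⁺ ∪ Ω⁻, one has (∫_{Ω⁺} (|u(x)|² + ‖Du(x)‖_F²) dx)^{1/2} + (∫_{Ω⁻} (|u(x)|² + ‖Du(x)‖_F²) dx)^{1/2} ≤ C [ (∫_{Ω⁺} ‖ε(u)(x)‖_F² dx)^{1/2} + (∫_{Ω⁻} ‖ε(u)(x)‖_F² dx)^{1/2} ], with integrals taken with respect to Lebesgue measure on ℝ². -/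
noncomputable section

open Matrix

/-- The plane `ℝ²`. -/
abbrev E2 := EuclideanSpace ℝ (Fin 2)

/-- The `i`-th standard basis vector of `ℝ²`. -/
def basisE (i : Fin 2) : E2 := EuclideanSpace.single i 1

/-- `Du(x)`: the Jacobian matrix of a vector field `u : ℝ² → ℝ²` at `x`. -/
def jacMat (u : E2 → E2) (x : E2) : Matrix (Fin 2) (Fin 2) ℝ :=
  Matrix.of fun i j => fderiv ℝ u x (basisE j) i

/-- `ε(u)(x) = (Du(x) + Du(x)ᵀ)/2`: the symmetric gradient of `u` at `x`. -/
def symGrad (u : E2 → E2) (x : E2) : Matrix (Fin 2) (Fin 2) ℝ :=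
  (2⁻¹ : ℝ) • (jacMat u x + (jacMat u x)ᵀ)

/-- The Frobenius norm of a 2×2 real matrix. -/
def frobNorm (A : Matrix (Fin 2) (Fin 2) ℝ) : ℝ :=
  Real.sqrt (∑ i, ∑ j, (A i j) ^ 2)

/-- `x^⊥ = (-x₂, x₁)`: counterclockwise rotation of `x` by `π/2`. -/
def perp (x : E2) : E2 := (EuclideanSpace.equiv (Fin 2) ℝ).symm ![-x 1, x 0]

/-- The divergence of a vector field `u : ℝ² → ℝ²` at `x`. -/
def divg (u : E2 → E2) (x : E2) : ℝ := ∑ i, fderiv ℝ u x (basisE i) i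

/-- The `i`-th component of the (componentwise) Laplacian of `u : ℝ² → ℝ²` at `x`. -/
def lap (u : E2 → E2) (x : E2) (i : Fin 2) : ℝ :=
  ∑ j, fderiv ℝ (fun y => fderiv ℝ u y (basisE j) i) x (basisE j)

/-- The Cauchy stress tensor `σ(u,p)(x) = 2ν ε(u)(x) - p(x)·I`. -/
def stress (ν : ℝ) (u : E2 → E2) (p : E2 → ℝ) (x : E2) : Matrix (Fin 2) (Fin 2) ℝ :=
  (2 * ν) • symGrad u x - p x • (1 : Matrix (Fin 2) (Fin 2) ℝ)

/-- The inner region: the open unit disc. -/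
def innerRegion : Set E2 := Metric.ball 0 1

/-- The outer region: the open annulus between radii `1` and `R`. -/
def outerRegion (R : ℝ) : Set E2 := {x : E2 | 1 < ‖x‖ ∧ ‖x‖ < R}

open MeasureTheory Filter Topology

theorem finite_setOf_norm_add_smul_eq {E : Type*} [NormedAddCommGroup E] [InnerProductSpace ℝ E]
    (x : E) {v : E} (hv : v ≠ 0) (r : ℝ) : {t : ℝ | ‖x + t • v‖ = r}.Finite := by
  let p : Polynomial ℝ := Polynomial.C (‖v‖ ^ 2) * Polynomial.X ^ 2 +
    Polynomial.C (2 * inner ℝ x v) * Polynomial.X + Polynomial.C (‖x‖ ^ 2 - r ^ 2)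
  have hp : p ≠ 0 := by
    intro h
    have h2 := congrArg (fun q => Polynomial.coeff q 2) h
    simp only [p, Polynomial.coeff_add, Polynomial.coeff_C_mul, Polynomial.coeff_X_pow,
      Polynomial.coeff_X, Polynomial.coeff_C, Polynomial.coeff_zero] at h2
    norm_num at h2
    exact hv h2
  refine (Polynomial.finite_setOfPred_isRoot hp).subset fun t ht => ?_
  have ht' : ‖x + t • v‖ = r := ht
  have h1 : ‖x + t • v‖ ^ 2 = ‖x‖ ^ 2 + 2 * (t * inner ℝ x v) + t ^ 2 * ‖v‖ ^ 2 := by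
    rw [norm_add_sq_real, inner_smul_right, norm_smul, mul_pow, Real.norm_eq_abs, sq_abs]
  change Polynomial.eval t p = 0
  simp only [p, Polynomial.eval_add, Polynomial.eval_mul, Polynomial.eval_C, Polynomial.eval_pow,
    Polynomial.eval_X]
  rw [← ht', h1]
  ring

theorem abs_sub_le_of_hasDerivAt_off_countable {g g' : ℝ → ℝ} {s : Set ℝ} (hs : s.Countable)
    {M : ℝ} (hc : Continuous g) (hd : ∀ t ∉ s, HasDerivAt g (g' t) t) (hM : ∀ t ∉ s, |g' t| ≤ M)
    (a b : ℝ) : |g b - g a| ≤ M * |b - a| := by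
  have hae : ∀ᵐ t : ℝ, t ∉ s := (measure_eq_zero_iff_ae_notMem).1 (hs.measure_zero volume)
  have hint : IntervalIntegrable (deriv g) volume a b := by
    refine (intervalIntegrable_const (c := M)).mono_fun
      (measurable_deriv g).aestronglyMeasurable ?_
    filter_upwards [ae_restrict_of_ae hae] with t ht
    rw [(hd t ht).deriv]
    exact (hM t ht).trans (le_abs_self M)
  rw [← integral_eq_of_hasDerivAt_off_countable g (deriv g) hs hc.continuousOn
    (fun t ht => (hd t ht.2).differentiableAt.hasDerivAt) hint, ← Real.norm_eq_abs]
  refine intervalIntegral.norm_integral_le_of_norm_le_const_ae ?_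
  filter_upwards [hae] with t ht _
  rw [(hd t ht).deriv]
  exact hM t ht

/-- A continuous function whose derivative is bounded off two spheres is Lipschitz. -/
theorem lipschitzWith_of_fderiv_le_off_spheres {E : Type*} [NormedAddCommGroup E]
    [InnerProductSpace ℝ E] {f : E → ℝ} (hf : Continuous f) {r₁ r₂ : ℝ} {M : NNReal}
    (hd : ∀ x, ‖x‖ ≠ r₁ → ‖x‖ ≠ r₂ → DifferentiableAt ℝ f x)
    (hM : ∀ x, ‖x‖ ≠ r₁ → ‖x‖ ≠ r₂ → ∀ v, |fderiv ℝ f x v| ≤ M * ‖v‖) :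
    LipschitzWith M f := by
  refine LipschitzWith.of_dist_le_mul fun y x => ?_
  rcases eq_or_ne y x with rfl | hxy
  · simp
  have hv : y - x ≠ 0 := sub_ne_zero.2 hxy
  let s : Set ℝ := {t | ‖x + t • (y - x)‖ = r₁} ∪ {t | ‖x + t • (y - x)‖ = r₂}
  have hs : s.Countable := ((finite_setOf_norm_add_smul_eq x hv r₁).union
    (finite_setOf_norm_add_smul_eq x hv r₂)).countable
  have hs' : ∀ t ∉ s, ‖x + t • (y - x)‖ ≠ r₁ ∧ ‖x + t • (y - x)‖ ≠ r₂ := fun t ht =>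
    ⟨fun h => ht (Or.inl h), fun h => ht (Or.inr h)⟩
  have key := abs_sub_le_of_hasDerivAt_off_countable (g := fun t => f (x + t • (y - x)))
    (g' := fun t => fderiv ℝ f (x + t • (y - x)) (y - x)) hs (M := M * ‖y - x‖)
    (by fun_prop)
    (fun t ht => by
      have h1 : HasDerivAt (fun t : ℝ => x + t • (y - x)) (y - x) t := by
        simpa using ((hasDerivAt_id t).smul_const (y - x)).const_add x
      exact (hd _ (hs' t ht).1 (hs' t ht).2).hasFDerivAt.comp_hasDerivAt t h1)
    (fun t ht => hM _ (hs' t ht).1 (hs' t ht).2 _) 0 1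
  simpa [dist_eq_norm] using key

theorem HasCompactSupport.lineDeriv {E : Type*} [NormedAddCommGroup E] [NormedSpace ℝ E]
    {f : E → ℝ} (hf : HasCompactSupport f) (v : E) :
    HasCompactSupport fun x => lineDeriv ℝ f x v := by
  refine HasCompactSupport.of_support_subset_isCompact hf fun x hx => ?_
  by_contra h
  refine hx ?_
  have h0 : f =ᶠ[𝓝 x] fun _ => 0 := notMem_tsupport_iff_eventuallyEq.1 h
  simp only [h0.lineDeriv_eq]
  simp [_root_.lineDeriv]

theorem LipschitzWith.integrable_lineDeriv {E : Type*} [NormedAddCommGroup E] [NormedSpace ℝ E]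
    [MeasurableSpace E] [BorelSpace E] [FiniteDimensional ℝ E] {μ : Measure E} [μ.IsAddHaarMeasure]
    {f : E → ℝ} {C : NNReal} (hf : LipschitzWith C f) (h'f : HasCompactSupport f) (v : E) :
    Integrable (fun x => lineDeriv ℝ f x v) μ :=
  (integrableOn_iff_integrable_of_support_subset (subset_tsupport _)).1
    ((hf.locallyIntegrable_lineDeriv v).integrableOn_isCompact (h'f.lineDeriv v))

/-- For compactly supported Lipschitz functions, `∂ᵥf ∂_w g` and `∂_w f ∂ᵥg` have the same
integral. -/
theorem LipschitzWith.integral_lineDeriv_mul_lineDeriv_comm {E : Type*} [NormedAddCommGroup E]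
    [NormedSpace ℝ E] [MeasurableSpace E] [BorelSpace E] [FiniteDimensional ℝ E] {μ : Measure E}
    [μ.IsAddHaarMeasure] {f g : E → ℝ} {C D : NNReal} (hf : LipschitzWith C f)
    (hg : LipschitzWith D g) (h'f : HasCompactSupport f) (h'g : HasCompactSupport g) (v w : E) :
    ∫ x, lineDeriv ℝ f x v * lineDeriv ℝ g x w ∂μ =
      ∫ x, lineDeriv ℝ f x w * lineDeriv ℝ g x v ∂μ := by
  have If := hf.integrable_lineDeriv (μ := μ) h'f v
  have Ig := hg.integrable_lineDeriv (μ := μ) h'g (-v)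
  have A := hg.integral_inv_smul_sub_mul_tendsto_integral_lineDeriv_mul If w
  have B := hf.integral_inv_smul_sub_mul_tendsto_integral_lineDeriv_mul Ig (-w)
  have hbound : ∀ {h k : E → ℝ} {K : NNReal}, LipschitzWith K h → HasCompactSupport h →
      Integrable k μ → ∀ c : E, Integrable (fun x => h (x + c) * k x) μ := by
    intro h k K hh h'h hk c
    obtain ⟨B, hB⟩ := h'h.exists_bound_of_continuous hh.continuous
    exact hk.bdd_mul (c := B)
      (hh.continuous.comp (continuous_add_const c)).aestronglyMeasurable
      (.of_forall fun _ => hB _)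
  have hbound0 : ∀ {h k : E → ℝ} {K : NNReal}, LipschitzWith K h → HasCompactSupport h →
      Integrable k μ → Integrable (fun x => h x * k x) μ := by
    intro h k K hh h'h hk
    simpa using hbound hh h'h hk 0
  have S : ∀ t : ℝ, ∫ x, (t⁻¹ • (g (x + t • w) - g x)) * lineDeriv ℝ f x v ∂μ =
      ∫ x, (t⁻¹ • (f (x + t • (-w)) - f x)) * lineDeriv ℝ g x (-v) ∂μ := by
    intro t
    simp only [smul_eq_mul, mul_assoc, integral_const_mul, sub_mul]
    rw [integral_sub (hbound hg h'g If _) (hbound0 hg h'g If),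
      integral_sub (hbound hf h'f Ig _) (hbound0 hf h'f Ig)]
    have e0 := hf.integral_lineDeriv_mul_eq (μ := μ) hg h'g v
    have hgt : LipschitzWith D fun x => g (x + t • w) := by
      simpa [Function.comp_def] using
        hg.comp ((LipschitzWith.id).add (LipschitzWith.const (t • w)))
    have h'gt : HasCompactSupport fun x => g (x + t • w) :=
      h'g.comp_homeomorph (Homeomorph.addRight (t • w))
    have e1 := hf.integral_lineDeriv_mul_eq (μ := μ) hgt h'gt v
    have e2 : ∀ x, lineDeriv ℝ (fun x => g (x + t • w)) x (-v) = lineDeriv ℝ g (x + t • w) (-v) := by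
      intro x
      simp only [lineDeriv, add_right_comm]
    have e3 : ∫ x, lineDeriv ℝ g (x + t • w) (-v) * f x ∂μ =
        ∫ x, lineDeriv ℝ g x (-v) * f (x + t • (-w)) ∂μ := by
      rw [← integral_add_right_eq_self _ (t • (-w))]
      simp
    simp only [e2, e3] at e1
    simp only [mul_comm] at e0 e1 ⊢
    rw [e0, e1]
  simp only [S] at A
  have := tendsto_nhds_unique A B
  simp only [lineDeriv_neg, neg_mul_neg] at this
  rw [← this]
  simp only [mul_comm]

theorem LipschitzWith.integral_lineDeriv_eq_zero {E : Type*} [NormedAddCommGroup E]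
    [NormedSpace ℝ E] [MeasurableSpace E] [BorelSpace E] [FiniteDimensional ℝ E] {μ : Measure E}
    [μ.IsAddHaarMeasure] {f : E → ℝ} {C : NNReal} (hf : LipschitzWith C f)
    (h'f : HasCompactSupport f) (v : E) : ∫ x, lineDeriv ℝ f x v ∂μ = 0 := by
  have := (LipschitzWith.const (α := E) (1 : ℝ)).integral_lineDeriv_mul_eq (μ := μ) hf h'f (-v)
  have h1 : ∀ x, lineDeriv ℝ (fun _ : E => (1 : ℝ)) x (-v) = 0 := fun x => by simp [lineDeriv]
  simpa [h1] using this.symm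

theorem LipschitzWith.mul_of_bounded {α : Type*} [PseudoMetricSpace α] {f g : α → ℝ}
    {C D A B : NNReal} (hf : LipschitzWith C f) (hg : LipschitzWith D g)
    (hA : ∀ x, ‖f x‖ ≤ A) (hB : ∀ x, ‖g x‖ ≤ B) :
    LipschitzWith (A * D + C * B) fun x => f x * g x := by
  refine LipschitzWith.of_dist_le_mul fun x y => ?_
  have h1 := hf.dist_le_mul x y
  have h2 := hg.dist_le_mul x y
  rw [dist_eq_norm] at h1 h2 ⊢
  calc ‖f x * g x - f y * g y‖ = ‖f x * (g x - g y) + (f x - f y) * g y‖ := by ring_nf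
    _ ≤ ‖f x‖ * ‖g x - g y‖ + ‖f x - f y‖ * ‖g y‖ := by
        refine (norm_add_le _ _).trans_eq ?_
        rw [norm_mul, norm_mul]
    _ ≤ A * (D * dist x y) + C * dist x y * B := by
        gcongr
        · exact hA x
        · exact hB y
    _ = _ := by push_cast; ring

theorem norm_basisE (i : Fin 2) : ‖basisE i‖ = 1 := by
  simp [basisE]

/-- Poincaré inequality for Lipschitz functions supported in a disc. -/
theorem integral_sq_le_integral_lineDeriv_sq {f : E2 → ℝ} {C : NNReal} (hf : LipschitzWith C f)
    {R : NNReal} (h0 : ∀ x, R < ‖x‖ → f x = 0) :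
    ∫ x, f x ^ 2 ≤ 4 * (R : ℝ) ^ 2 * ∫ x, lineDeriv ℝ f x (basisE 0) ^ 2 := by
  have h'f : HasCompactSupport f := HasCompactSupport.intro (isCompact_closedBall (0 : E2) R)
    fun x hx => h0 x (by simpa using hx)
  obtain ⟨B, hB⟩ := h'f.exists_bound_of_continuous hf.continuous
  have hB0 : 0 ≤ B := (norm_nonneg _).trans (hB 0)
  lift B to NNReal using hB0
  let φ : E2 → ℝ := fun x => max (-(R : ℝ)) (min R (x 0))
  have hφ : LipschitzWith 1 φ := by
    have h1 : LipschitzWith 1 fun x : E2 => x 0 := by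
      refine LipschitzWith.of_dist_le_mul fun x y => ?_
      simpa [dist_eq_norm] using PiLp.norm_apply_le (x - y) 0
    exact (h1.const_min _).const_max _
  have hφR : ∀ x, ‖φ x‖ ≤ R := fun x => by
    rw [Real.norm_eq_abs, abs_le]
    exact ⟨le_max_left _ _, max_le (by linarith [R.coe_nonneg]) (min_le_left _ _)⟩
  have hφx : ∀ x, φ x * (f x * f x) = x 0 * (f x * f x) := fun x => by
    rcases le_or_gt ‖x‖ R with h | h
    · have h2 := abs_le.1 ((PiLp.norm_apply_le x 0).trans h)
      simp only [φ]
      rw [min_eq_right h2.2, max_eq_right h2.1]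
    · simp [h0 x h]
  have hff := hf.mul_of_bounded hf hB hB
  have hh := hφ.mul_of_bounded hff hφR (B := B * B) (fun x => by
    rw [norm_mul]
    push_cast
    exact mul_le_mul (hB x) (hB x) (norm_nonneg _) B.coe_nonneg)
  have h'h : HasCompactSupport fun x => φ x * (f x * f x) := h'f.mul_left.mul_left
  have hzero := hh.integral_lineDeriv_eq_zero (μ := volume) h'h (basisE 0)
  have hder : ∀ᵐ x : E2, lineDeriv ℝ (fun x => φ x * (f x * f x)) x (basisE 0) =
      f x ^ 2 + 2 * x 0 * f x * lineDeriv ℝ f x (basisE 0) := by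
    filter_upwards [hf.ae_lineDifferentiableAt (μ := volume) (basisE 0)] with x hx
    simp only [hφx]
    have d1 : HasDerivAt (fun t : ℝ => f (x + t • basisE 0)) (lineDeriv ℝ f x (basisE 0)) 0 :=
      hx.hasLineDerivAt
    have d2 : HasDerivAt (fun t : ℝ => (x + t • basisE 0) 0) 1 0 := by
      simpa [basisE] using (hasDerivAt_id (0 : ℝ)).const_add (x 0)
    have d3 := d2.mul (d1.mul d1)
    refine (show HasLineDerivAt ℝ (fun x : E2 => x 0 * (f x * f x)) _ x (basisE 0) from
      d3).lineDeriv.trans ?_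
    simp
    ring
  have If2 : Integrable fun x => f x ^ 2 :=
    (hf.continuous.pow 2).integrable_of_hasCompactSupport (by simpa [sq] using h'f.mul_left)
  have Id2 : Integrable fun x => lineDeriv ℝ f x (basisE 0) ^ 2 := by
    simp only [sq]
    exact (hf.integrable_lineDeriv h'f _).bdd_mul (c := C * ‖basisE 0‖)
      (aestronglyMeasurable_lineDeriv hf.continuous _)
      (.of_forall fun _ => norm_lineDeriv_le_of_lipschitz ℝ hf)
  have hle : ∫ x, ((1 / 2) * f x ^ 2 - 2 * (R : ℝ) ^ 2 * lineDeriv ℝ f x (basisE 0) ^ 2) ≤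
      ∫ x, lineDeriv ℝ (fun x => φ x * (f x * f x)) x (basisE 0) := by
    refine integral_mono_ae ((If2.const_mul _).sub (Id2.const_mul _))
      (hh.integrable_lineDeriv h'h _) ?_
    filter_upwards [hder] with x hx
    rw [hx]
    rcases le_or_gt ‖x‖ R with h | h
    · have h2 : x 0 ^ 2 ≤ (R : ℝ) ^ 2 := sq_le_sq.2
        (((PiLp.norm_apply_le x 0).trans h).trans (le_abs_self _))
      nlinarith [sq_nonneg (f x + 2 * x 0 * lineDeriv ℝ f x (basisE 0)),
        mul_le_mul_of_nonneg_right h2 (sq_nonneg (lineDeriv ℝ f x (basisE 0)))]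
    · rw [h0 x h]
      nlinarith [mul_nonneg (sq_nonneg (R : ℝ)) (sq_nonneg (lineDeriv ℝ f x (basisE 0)))]
  rw [hzero, integral_sub (If2.const_mul _) (Id2.const_mul _), integral_const_mul,
    integral_const_mul] at hle
  linarith

theorem LipschitzWith.integrable_lineDeriv_mul {f g : E2 → ℝ} {C D : NNReal}
    (hf : LipschitzWith C f) (hg : LipschitzWith D g) (h'g : HasCompactSupport g) (v w : E2) :
    Integrable fun x => lineDeriv ℝ f x v * lineDeriv ℝ g x w :=
  (hg.integrable_lineDeriv h'g _).bdd_mul (c := C * ‖v‖)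
    (aestronglyMeasurable_lineDeriv hf.continuous _)
    (.of_forall fun _ => norm_lineDeriv_le_of_lipschitz ℝ hf)

/-- Squared norms of the value and of the gradient of the field with components `f`. -/
def energyDensity (f : Fin 2 → E2 → ℝ) (x : E2) : ℝ :=
  ∑ i, f i x ^ 2 + ∑ i, ∑ j, lineDeriv ℝ (f i) x (basisE j) ^ 2

/-- Squared norm of the symmetric gradient of the field with components `f`. -/
def strainDensity (f : Fin 2 → E2 → ℝ) (x : E2) : ℝ :=
  ∑ i, ∑ j, (2⁻¹ * (lineDeriv ℝ (f i) x (basisE j) + lineDeriv ℝ (f j) x (basisE i))) ^ 2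

theorem integrable_energyDensity {f : Fin 2 → E2 → ℝ} {C : NNReal}
    (hf : ∀ i, LipschitzWith C (f i)) (h'f : ∀ i, HasCompactSupport (f i)) :
    Integrable (energyDensity f) := by
  refine (integrable_finsetSum _ fun i _ => ?_).add
    (integrable_finsetSum _ fun i _ => integrable_finsetSum _ fun j _ => ?_)
  · exact ((hf i).continuous.pow 2).integrable_of_hasCompactSupport
      (by simpa [sq] using (h'f i).mul_left)
  · simpa only [sq] using (hf i).integrable_lineDeriv_mul (hf i) (h'f i) (basisE j) (basisE j)

theorem integrable_strainDensity {f : Fin 2 → E2 → ℝ} {C : NNReal}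
    (hf : ∀ i, LipschitzWith C (f i)) (h'f : ∀ i, HasCompactSupport (f i)) :
    Integrable (strainDensity f) := by
  refine integrable_finsetSum _ fun i _ => integrable_finsetSum _ fun j _ => ?_
  have e : (fun x => (2⁻¹ * (lineDeriv ℝ (f i) x (basisE j) +
      lineDeriv ℝ (f j) x (basisE i))) ^ 2) = fun x =>
      4⁻¹ * (lineDeriv ℝ (f i) x (basisE j) * lineDeriv ℝ (f i) x (basisE j)) +
      2⁻¹ * (lineDeriv ℝ (f i) x (basisE j) * lineDeriv ℝ (f j) x (basisE i)) +
      4⁻¹ * (lineDeriv ℝ (f j) x (basisE i) * lineDeriv ℝ (f j) x (basisE i)) := by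
    ext x
    ring
  rw [e]
  exact ((((hf i).integrable_lineDeriv_mul (hf i) (h'f i) _ _).const_mul _).add
    (((hf i).integrable_lineDeriv_mul (hf j) (h'f j) _ _).const_mul _)).add
    (((hf j).integrable_lineDeriv_mul (hf j) (h'f j) _ _).const_mul _)

/-- Korn–Poincaré inequality for Lipschitz fields supported in a disc. -/
theorem integral_energyDensity_le {f : Fin 2 → E2 → ℝ} {C : NNReal}
    (hf : ∀ i, LipschitzWith C (f i)) {R : NNReal} (h0 : ∀ i x, R < ‖x‖ → f i x = 0) :
    ∫ x, energyDensity f x ≤ (2 + 8 * (R : ℝ) ^ 2) * ∫ x, strainDensity f x := by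
  have h'f : ∀ i, HasCompactSupport (f i) := fun i =>
    HasCompactSupport.intro (isCompact_closedBall (0 : E2) R)
      fun x hx => h0 i x (by simpa using hx)
  have I : ∀ i j k l, Integrable fun x =>
      lineDeriv ℝ (f i) x (basisE k) * lineDeriv ℝ (f j) x (basisE l) := fun i j k l =>
    (hf i).integrable_lineDeriv_mul (hf j) (h'f j) _ _
  have I2 : ∀ i k, Integrable fun x => lineDeriv ℝ (f i) x (basisE k) ^ 2 := fun i k => by
    simpa only [sq] using I i i k k
  have IF : ∀ i, Integrable fun x => f i x ^ 2 := fun i =>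
    ((hf i).continuous.pow 2).integrable_of_hasCompactSupport
      (by simpa [sq] using (h'f i).mul_left)
  have hdet := (hf 0).integral_lineDeriv_mul_lineDeriv_comm (μ := volume) (hf 1) (h'f 0) (h'f 1)
    (basisE 0) (basisE 1)
  have IJ : Integrable fun x =>
      2 * (lineDeriv ℝ (f 0) x (basisE 0) * lineDeriv ℝ (f 1) x (basisE 1) -
        lineDeriv ℝ (f 0) x (basisE 1) * lineDeriv ℝ (f 1) x (basisE 0)) :=
    ((I 0 1 0 1).sub (I 0 1 1 0)).const_mul 2
  have hgrad : ∫ x, ∑ i, ∑ j, lineDeriv ℝ (f i) x (basisE j) ^ 2 ≤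
      2 * ∫ x, strainDensity f x := by
    have : ∫ x, (2 * strainDensity f x +
        2 * (lineDeriv ℝ (f 0) x (basisE 0) * lineDeriv ℝ (f 1) x (basisE 1) -
          lineDeriv ℝ (f 0) x (basisE 1) * lineDeriv ℝ (f 1) x (basisE 0))) =
        2 * ∫ x, strainDensity f x := by
      rw [integral_add ((integrable_strainDensity hf h'f).const_mul 2)
        IJ, integral_const_mul, integral_const_mul,
        integral_sub (I 0 1 0 1) (I 0 1 1 0), hdet, sub_self, mul_zero, add_zero]
    rw [← this]
    refine integral_mono (integrable_finsetSum _ fun i _ => integrable_finsetSum _ fun j _ =>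
      I2 i j) (((integrable_strainDensity hf h'f).const_mul 2).add IJ) fun x => ?_
    simp only [strainDensity, Fin.sum_univ_two]
    nlinarith [sq_nonneg (lineDeriv ℝ (f 0) x (basisE 0) + lineDeriv ℝ (f 1) x (basisE 1))]
  have hval : ∫ x, ∑ i, f i x ^ 2 ≤
      4 * (R : ℝ) ^ 2 * ∫ x, ∑ i, ∑ j, lineDeriv ℝ (f i) x (basisE j) ^ 2 := by
    rw [integral_finsetSum _ fun i _ => IF i, integral_finsetSum _ fun i _ =>
      integrable_finsetSum _ fun j _ => I2 i j, Finset.mul_sum]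
    refine Finset.sum_le_sum fun i _ =>
      (integral_sq_le_integral_lineDeriv_sq (hf i) (h0 i)).trans ?_
    refine mul_le_mul_of_nonneg_left (integral_mono (I2 i 0)
      (integrable_finsetSum _ fun j _ => I2 i j) fun x => ?_) (by positivity)
    simp only [Fin.sum_univ_two]
    nlinarith [sq_nonneg (lineDeriv ℝ (f i) x (basisE 1))]
  simp only [energyDensity]
  rw [integral_add (integrable_finsetSum _ fun i _ => IF i)
    (integrable_finsetSum _ fun i _ => integrable_finsetSum _ fun j _ => I2 i j)]
  have := mul_le_mul_of_nonneg_left hgrad (show 0 ≤ 4 * (R : ℝ) ^ 2 by positivity)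
  linarith

theorem frobNorm_sq (A : Matrix (Fin 2) (Fin 2) ℝ) : frobNorm A ^ 2 = ∑ i, ∑ j, A i j ^ 2 :=
  Real.sq_sqrt (Finset.sum_nonneg fun _ _ => Finset.sum_nonneg fun _ _ => sq_nonneg _)

theorem abs_entry_le_frobNorm (A : Matrix (Fin 2) (Fin 2) ℝ) (i j : Fin 2) :
    |A i j| ≤ frobNorm A :=
  Real.abs_le_sqrt ((Finset.single_le_sum (f := fun j => A i j ^ 2) (fun _ _ => sq_nonneg _)
    (Finset.mem_univ j)).trans (Finset.single_le_sum (f := fun i => ∑ j, A i j ^ 2)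
      (fun _ _ => Finset.sum_nonneg fun _ _ => sq_nonneg _) (Finset.mem_univ i)))

theorem abs_fderiv_apply_le (u : E2 → E2) (x v : E2) (i : Fin 2) :
    |fderiv ℝ u x v i| ≤ 2 * frobNorm (jacMat u x) * ‖v‖ := by
  have hv : v = v 0 • basisE 0 + v 1 • basisE 1 := by
    ext k
    fin_cases k <;> simp [basisE]
  have h1 : fderiv ℝ u x v i = v 0 * jacMat u x i 0 + v 1 * jacMat u x i 1 := by
    conv_lhs => rw [hv]
    simp [jacMat]
  have h2 : ∀ j, |v j * jacMat u x i j| ≤ ‖v‖ * frobNorm (jacMat u x) := fun j => by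
    rw [abs_mul]
    exact mul_le_mul (PiLp.norm_apply_le v j) (abs_entry_le_frobNorm _ i j) (abs_nonneg _)
      (norm_nonneg _)
  rw [h1]
  refine (abs_add_le _ _).trans ?_
  linarith [h2 0, h2 1]

theorem setIntegral_add_setIntegral_eq_integral {α : Type*} [MeasurableSpace α] {μ : Measure α}
    {s t : Set α} {g h : α → ℝ} (hs : MeasurableSet s) (ht : MeasurableSet t)
    (hst : Disjoint s t) (hg : Integrable g μ) (heq : ∀ x ∈ s ∪ t, h x = g x)
    (h0 : ∀ᵐ x ∂μ, x ∉ s ∪ t → g x = 0) :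
    ∫ x in s, h x ∂μ + ∫ x in t, h x ∂μ = ∫ x, g x ∂μ := by
  rw [setIntegral_congr_fun hs fun x hx => heq x (Or.inl hx),
    setIntegral_congr_fun ht fun x hx => heq x (Or.inr hx),
    ← setIntegral_union hst ht hg.integrableOn hg.integrableOn,
    setIntegral_eq_integral_of_ae_compl_eq_zero h0]

theorem sqrt_add_le_sqrt_add_sqrt {a b : ℝ} (ha : 0 ≤ a) (hb : 0 ≤ b) : √(a + b) ≤ √a + √b := by
  refine Real.sqrt_le_iff.2 ⟨by positivity, ?_⟩
  nlinarith [Real.sq_sqrt ha, Real.sq_sqrt hb, mul_nonneg (Real.sqrt_nonneg a) (Real.sqrt_nonneg b)]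

theorem measurableSet_outerRegion (R : ℝ) : MeasurableSet (outerRegion R) :=
  (isOpen_lt continuous_const continuous_norm).measurableSet.inter
    (isOpen_lt continuous_norm continuous_const).measurableSet

theorem disjoint_outerRegion_innerRegion (R : ℝ) : Disjoint (outerRegion R) innerRegion :=
  Set.disjoint_left.2 fun x hx hx' => by
    have h : ‖x‖ < 1 := by simpa [innerRegion] using hx'
    exact lt_asymm hx.1 h

theorem norm_lt_of_mem_regions {R : ℝ} (hR : 1 < R) {x : E2}
    (hx : x ∈ outerRegion R ∪ innerRegion) : ‖x‖ < R := by
  rcases hx with h | h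
  · exact h.2
  · have h : ‖x‖ < 1 := by simpa [innerRegion] using h
    exact h.trans hR

theorem mem_regions {R : ℝ} {x : E2} (h1 : ‖x‖ ≠ 1) (hx : ‖x‖ < R) :
    x ∈ outerRegion R ∪ innerRegion := by
  rcases lt_or_gt_of_ne h1 with h | h
  · exact Or.inr (by simpa [innerRegion] using h)
  · exact Or.inl ⟨h, hx⟩

/-- The `i`-th component of `u`, extended by zero outside the disc of radius `R`. -/
def extendedComponent (R : ℝ) (u : E2 → E2) (i : Fin 2) : E2 → ℝ :=
  (Metric.closedBall 0 R).indicator fun x => u x i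

theorem extendedComponent_of_lt {R : ℝ} {u : E2 → E2} {i : Fin 2} {x : E2} (hx : R < ‖x‖) :
    extendedComponent R u i x = 0 :=
  Set.indicator_of_notMem (by simpa using hx) _

theorem extendedComponent_of_le {R : ℝ} {u : E2 → E2} {i : Fin 2} {x : E2} (hx : ‖x‖ ≤ R) :
    extendedComponent R u i x = u x i :=
  Set.indicator_of_mem (by simpa using hx) _

theorem hasFDerivAt_extendedComponent_of_gt {R : ℝ} {u : E2 → E2} {i : Fin 2} {x : E2}
    (hx : R < ‖x‖) : HasFDerivAt (extendedComponent R u i) (0 : E2 →L[ℝ] ℝ) x := by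
  refine (hasFDerivAt_const (0 : ℝ) x).congr_of_eventuallyEq ?_
  filter_upwards [(isOpen_lt continuous_const continuous_norm).mem_nhds hx] with y hy
  exact extendedComponent_of_lt hy

theorem hasFDerivAt_extendedComponent_of_lt {R : ℝ} {u : E2 → E2} {i : Fin 2} {x : E2}
    (hx : ‖x‖ < R) (hu : DifferentiableAt ℝ u x) :
    HasFDerivAt (extendedComponent R u i)
      ((EuclideanSpace.proj i : E2 →L[ℝ] ℝ).comp (fderiv ℝ u x)) x := by
  refine ((EuclideanSpace.proj i : E2 →L[ℝ] ℝ).hasFDerivAt.comp x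
    hu.hasFDerivAt).congr_of_eventuallyEq ?_
  filter_upwards [(isOpen_lt continuous_norm continuous_const).mem_nhds hx] with y hy
  exact extendedComponent_of_le (le_of_lt hy)

theorem continuous_extendedComponent {R : ℝ} (hR : R ≠ 0) {u : E2 → E2}
    (hc : ContinuousOn u (Metric.closedBall 0 R))
    (h0 : ∀ x ∈ Metric.sphere (0 : E2) R, u x = 0) (i : Fin 2) :
    Continuous (extendedComponent R u i) := by
  refine continuous_indicator (fun x hx => ?_) ?_
  · rw [frontier_closedBall _ hR] at hx
    simp [h0 x hx]
  · rw [Metric.isClosed_closedBall.closure_eq]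
    exact (EuclideanSpace.proj i : E2 →L[ℝ] ℝ).continuous.comp_continuousOn hc

theorem lipschitzWith_extendedComponent {R : ℝ} (hR : R ≠ 0) {u : E2 → E2}
    (hc : ContinuousOn u (Metric.closedBall 0 R))
    (h0 : ∀ x ∈ Metric.sphere (0 : E2) R, u x = 0)
    (hd : ∀ x ∈ outerRegion R ∪ innerRegion, DifferentiableAt ℝ u x) {M : NNReal}
    (hM : ∀ x ∈ outerRegion R ∪ innerRegion, frobNorm (jacMat u x) ≤ M) (i : Fin 2) :
    LipschitzWith (2 * M) (extendedComponent R u i) := by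
  refine lipschitzWith_of_fderiv_le_off_spheres (r₁ := 1) (r₂ := R)
    (continuous_extendedComponent hR hc h0 i) (fun x h1 h2 => ?_) (fun x h1 h2 v => ?_)
  · rcases lt_or_gt_of_ne h2 with h | h
    · exact (hasFDerivAt_extendedComponent_of_lt h (hd x (mem_regions h1 h))).differentiableAt
    · exact (hasFDerivAt_extendedComponent_of_gt h).differentiableAt
  · rcases lt_or_gt_of_ne h2 with h | h
    · rw [(hasFDerivAt_extendedComponent_of_lt h (hd x (mem_regions h1 h))).fderiv]
      refine (abs_fderiv_apply_le u x v i).trans ?_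
      have := hM x (mem_regions h1 h)
      push_cast
      gcongr
    · rw [(hasFDerivAt_extendedComponent_of_gt h).fderiv]
      simp only [_root_.zero_apply, abs_zero]
      positivity

/-- Two-phase Korn–Poincaré inequality in the ball/annulus geometry. -/
theorem two_phase_korn_poincare (R : ℝ) (hR : 1 < R) :
    ∃ C > 0, ∀ u : E2 → E2,
      ContinuousOn u (Metric.closedBall 0 R) →
      (∀ x ∈ Metric.sphere (0 : E2) R, u x = 0) →
      (∀ x ∈ outerRegion R ∪ innerRegion, DifferentiableAt ℝ u x) →
      (∃ M, ∀ x ∈ outerRegion R ∪ innerRegion, frobNorm (jacMat u x) ≤ M) →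
      Real.sqrt (∫ x in outerRegion R, (‖u x‖ ^ 2 + frobNorm (jacMat u x) ^ 2))
        + Real.sqrt (∫ x in innerRegion, (‖u x‖ ^ 2 + frobNorm (jacMat u x) ^ 2))
      ≤ C * (Real.sqrt (∫ x in outerRegion R, frobNorm (symGrad u x) ^ 2)
        + Real.sqrt (∫ x in innerRegion, frobNorm (symGrad u x) ^ 2)) := by
  lift R to NNReal using by linarith
  refine ⟨2 * √(2 + 8 * (R : ℝ) ^ 2), by positivity, fun u hc h0 hd ⟨M, hM⟩ => ?_⟩
  have hR0 : (R : ℝ) ≠ 0 := by linarith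
  have hM' : ∀ x ∈ outerRegion R ∪ innerRegion, frobNorm (jacMat u x) ≤ M.toNNReal :=
    fun x hx => (hM x hx).trans (Real.le_coe_toNNReal M)
  let f := extendedComponent R u
  have hf : ∀ i, LipschitzWith (2 * M.toNNReal) (f i) :=
    lipschitzWith_extendedComponent hR0 hc h0 hd hM'
  have hf0 : ∀ i x, R < ‖x‖ → f i x = 0 := fun i x hx => extendedComponent_of_lt hx
  have h'f : ∀ i, HasCompactSupport (f i) := fun i =>
    HasCompactSupport.intro (isCompact_closedBall (0 : E2) R)
      fun x hx => hf0 i x (by simpa using hx)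
  have hjac : ∀ x ∈ outerRegion R ∪ innerRegion, ∀ i j,
      lineDeriv ℝ (f i) x (basisE j) = jacMat u x i j := fun x hx i j =>
    ((hasFDerivAt_extendedComponent_of_lt (norm_lt_of_mem_regions hR hx)
      (hd x hx)).hasLineDerivAt _).lineDeriv
  have hzero : ∀ᵐ x : E2, x ∉ outerRegion R ∪ innerRegion →
      ∀ i, f i x = 0 ∧ ∀ v, lineDeriv ℝ (f i) x v = 0 := by
    filter_upwards [measure_eq_zero_iff_ae_notMem.1 (Measure.addHaar_sphere volume (0 : E2) 1),
      measure_eq_zero_iff_ae_notMem.1 (Measure.addHaar_sphere volume (0 : E2) R)] with x h1 h2 hx i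
    have h1 : ‖x‖ ≠ 1 := by simpa using h1
    have h2 : ‖x‖ ≠ R := by simpa using h2
    have h : (R : ℝ) < ‖x‖ := (lt_or_gt_of_ne h2).resolve_left fun h => hx (mem_regions h1 h)
    exact ⟨hf0 i x h, fun v => by
      rw [((hasFDerivAt_extendedComponent_of_gt h).hasLineDerivAt v).lineDeriv]
      rfl⟩
  have hO := measurableSet_outerRegion R
  have hI : MeasurableSet innerRegion := Metric.isOpen_ball.measurableSet
  have hdisj := disjoint_outerRegion_innerRegion R
  have energy := setIntegral_add_setIntegral_eq_integral (μ := volume) hO hI hdisj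
    (h := fun x => ‖u x‖ ^ 2 + frobNorm (jacMat u x) ^ 2)
    (integrable_energyDensity hf h'f)
    (fun x hx => by
      have hu : ∀ i, f i x = u x i := fun i =>
        extendedComponent_of_le (norm_lt_of_mem_regions hR hx).le
      simp only [energyDensity, frobNorm_sq, EuclideanSpace.real_norm_sq_eq, hjac x hx, hu])
    (by
      filter_upwards [hzero] with x h hx
      simp [energyDensity, (h hx _).1, (h hx _).2])
  have strain := setIntegral_add_setIntegral_eq_integral (μ := volume) hO hI hdisj
    (h := fun x => frobNorm (symGrad u x) ^ 2)
    (integrable_strainDensity hf h'f)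
    (fun x hx => by
      simp [strainDensity, frobNorm_sq, symGrad, hjac x hx, mul_add])
    (by
      filter_upwards [hzero] with x h hx
      simp [strainDensity, (h hx _).2])
  have hkorn := integral_energyDensity_le hf hf0
  rw [← energy, ← strain] at hkorn
  have hnn : ∀ s : Set E2, 0 ≤ ∫ x in s, frobNorm (symGrad u x) ^ 2 :=
    fun s => integral_nonneg fun x => sq_nonneg _
  have hnn' : ∀ s : Set E2, 0 ≤ ∫ x in s, (‖u x‖ ^ 2 + frobNorm (jacMat u x) ^ 2) :=
    fun s => integral_nonneg fun x => by positivity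
  have hle := (Real.sqrt_le_sqrt hkorn).trans_eq (Real.sqrt_mul (by positivity) _)
  have hadd := sqrt_add_le_sqrt_add_sqrt (hnn (outerRegion R)) (hnn innerRegion)
  have h1 := Real.sqrt_le_sqrt (le_add_of_nonneg_right (hnn' innerRegion) :
    ∫ x in outerRegion R, (‖u x‖ ^ 2 + frobNorm (jacMat u x) ^ 2) ≤ _)
  have h2 := Real.sqrt_le_sqrt (le_add_of_nonneg_left (hnn' (outerRegion R)) :
    ∫ x in innerRegion, (‖u x‖ ^ 2 + frobNorm (jacMat u x) ^ 2) ≤ _)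
  have := mul_le_mul_of_nonneg_left hadd (Real.sqrt_nonneg (2 + 8 * (R : ℝ) ^ 2))
  linarith
end
end

section
/- (Characterization of the stationary state, first part of Lemma 1 of the paper, in the ball/annulus geometry.) Let R > 1 and ν > 0. Let u⁻ : ℝ² → ℝ² and p⁻ : ℝ² → ℝ be respectively twice and once continuously differentiable on an open set containing the closed unit ball {‖x‖ ≤ 1}, and let u⁺ : ℝ² → ℝ² and p⁺ : ℝ² → ℝ be respectively twice and once continuously differentiable on an open set containing the closed annulus {1 ≤ ‖x‖ ≤ R}. Assume that on their respective domains: div u⁻ = 0 and ν Δu⁻ = ∇p⁻ (componentwise) on the open unit ball; div u⁺ = 0 and ν Δu⁺ = ∇p⁺ on the open annulus {1 < ‖x‖ < R}; u⁺(x) = 0 whenever ‖x‖ = R; and u⁺(x) = u⁻(x) = 0 whenever ‖x‖ = 1. Then u⁺ vanishes on the closed annulus, u⁻ vanishes on the closed unit ball, p⁺ is constant on the closed annulus, p⁻ is constant on the closed unit ball, and there exists a constant c ∈ ℝ such that for every x with ‖x‖ = 1, (σ(u⁺,p⁺)(x) − σ(u⁻,p⁻)(x))·x = c·x, i.e. the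 jump of the normal stress across the unit circle is a constant multiple of the outward unit normal n(x) = x. -/
noncomputable section

open Matrix

open MeasureTheory Set Topology

section DirectionalDerivative

variable {E : Type*} [NormedAddCommGroup E] [NormedSpace ℝ E]

/-- On a bounded set whose closure lies in the domain, the directional derivative of a `C¹` function
is bounded after extension by zero. -/
lemma exists_bound_indicator_fderiv [FiniteDimensional ℝ E] {D U : Set E} {F : E → ℝ}
    (hDb : Bornology.IsBounded D) (hU : IsOpen U) (hDU : closure D ⊆ U)
    (hF : ContDiffOn ℝ 1 F U) (v : E) :
    ∃ C, ∀ x, ‖D.indicator (fun y => fderiv ℝ F y v) x‖ ≤ C := by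
  have := FiniteDimensional.proper ℝ E
  have hc : ContinuousOn (fun y => fderiv ℝ F y v) (closure D) :=
    ((hF.continuousOn_fderiv_of_isOpen hU le_rfl).mono hDU).clm_apply continuousOn_const
  obtain ⟨C, hC⟩ := hDb.isCompact_closure.exists_bound_of_continuousOn hc
  refine ⟨max C 0, fun x => ?_⟩
  by_cases hx : x ∈ D
  · rw [indicator_of_mem hx]
    exact (hC x (subset_closure hx)).trans (le_max_left _ _)
  · simp [hx]

/-- A `C¹` function vanishing on the boundary of a bounded open set has directional derivative of
zero mean along every line meeting that boundary in countably many points. -/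
lemma integral_indicator_fderiv_line_eq_zero [FiniteDimensional ℝ E] [MeasurableSpace E]
    [BorelSpace E] {D U : Set E} {F : E → ℝ}
    (hD : IsOpen D) (hDb : Bornology.IsBounded D) (hU : IsOpen U) (hDU : closure D ⊆ U)
    (hF : ContDiffOn ℝ 1 F U) (hF0 : ∀ x ∈ frontier D, F x = 0) (x v : E) (hv : v ≠ 0)
    (hcount : {t : ℝ | x + t • v ∈ frontier D}.Countable) :
    ∫ t : ℝ, D.indicator (fun y => fderiv ℝ F y v) (x + t • v) = 0 := by
  set γ : ℝ → E := fun t => x + t • v with hγ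
  have hγc : Continuous γ := by fun_prop
  obtain ⟨C, hC⟩ := exists_bound_indicator_fderiv hDb hU hDU hF v
  obtain ⟨B, hB⟩ := hDb.exists_norm_le
  obtain ⟨M, hM⟩ : ∃ M, ∀ t, γ t ∈ D → |t| < M := by
    refine ⟨(B + ‖x‖) / ‖v‖ + 1, fun t ht => lt_add_of_le_of_pos ?_ one_pos⟩
    rw [le_div_iff₀ (norm_pos_iff.2 hv), ← Real.norm_eq_abs, ← norm_smul]
    calc ‖t • v‖ = ‖γ t - x‖ := by simp [hγ]
      _ ≤ ‖γ t‖ + ‖x‖ := norm_sub_le _ _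
      _ ≤ B + ‖x‖ := by gcongr; exact hB _ ht
  have hM' : ∀ t, M ≤ |t| → γ t ∉ D := fun t ht h => absurd (hM t h) ht.not_gt
  rw [← intervalIntegral.integral_eq_integral_of_support_subset (a := -M) (b := M)]
  · have hcont : Continuous (D.indicator F) :=
      continuous_indicator hF0 (hF.continuousOn.mono hDU)
    have hmeas : Measurable fun t => D.indicator (fun y => fderiv ℝ F y v) (γ t) :=
      ((measurable_fderiv_apply_const ℝ F v).indicator hD.measurableSet).comp hγc.measurable
    rw [integral_eq_of_hasDerivAt_off_countable (fun t => D.indicator F (γ t)) _ hcount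
      (hcont.comp hγc).continuousOn]
    · rw [indicator_of_notMem (hM' M (le_abs_self M)),
        indicator_of_notMem (hM' (-M) (by rw [abs_neg]; exact le_abs_self M)), sub_zero]
    · intro t ht
      have hfr : γ t ∉ frontier D := ht.2
      by_cases htD : γ t ∈ D
      · rw [indicator_of_mem htD]
        have hd : HasFDerivAt F (fderiv ℝ F (γ t)) (γ t) :=
          ((hF.differentiableOn one_ne_zero).differentiableAt
            (hU.mem_nhds (hDU (subset_closure htD)))).hasFDerivAt
        have hγd : HasDerivAt γ v t := by
          simpa [hγ] using ((hasDerivAt_id t).smul_const v).const_add x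
        refine (hd.comp_hasDerivAt t hγd).congr_of_eventuallyEq ?_
        filter_upwards [hγc.continuousAt.preimage_mem_nhds (hD.mem_nhds htD)] with s hs
        exact indicator_of_mem (s := D) hs F
      · rw [indicator_of_notMem htD]
        have hcl : γ t ∈ (closure D)ᶜ := fun h => hfr (hD.frontier_eq ▸ ⟨h, htD⟩)
        refine (hasDerivAt_const t (0 : ℝ)).congr_of_eventuallyEq ?_
        filter_upwards [hγc.continuousAt.preimage_mem_nhds
          (isClosed_closure.isOpen_compl.mem_nhds hcl)] with s hs
        exact indicator_of_notMem (fun h => hs (subset_closure h)) F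
    · exact intervalIntegrable_const (c := C) |>.mono_fun hmeas.aestronglyMeasurable
        (Filter.Eventually.of_forall fun t => (hC _).trans (le_abs_self C))
  · intro t ht
    have htD : γ t ∈ D := by
      by_contra h
      exact ht (indicator_of_notMem h _)
    have := abs_lt.1 (hM t htD)
    exact ⟨this.1, this.2.le⟩

end DirectionalDerivative

/-- The point of the plane with the given Cartesian coordinates. -/
def planePoint (z : ℝ × ℝ) : E2 := z.1 • basisE 0 + z.2 • basisE 1

lemma continuous_planePoint : Continuous planePoint := by
  unfold planePoint; fun_prop

lemma planePoint_coords (x : E2) : planePoint (x 0, x 1) = x := by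
  ext i; fin_cases i <;> simp [planePoint, basisE]

lemma basisE_ne_zero (i : Fin 2) : basisE i ≠ 0 := by
  simp [basisE]

/-- Every line parallel to a coordinate axis meets the set in countably many points. -/
def CountableOnAxisLines (S : Set E2) : Prop :=
  ∀ (j : Fin 2) (x : E2), {t : ℝ | x + t • basisE j ∈ S}.Countable

lemma integrable_indicator_fderiv_planePoint {D U : Set E2} {F : E2 → ℝ}
    (hD : IsOpen D) (hDb : Bornology.IsBounded D) (hU : IsOpen U) (hDU : closure D ⊆ U)
    (hF : ContDiffOn ℝ 1 F U) (v : E2) :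
    Integrable fun z => D.indicator (fun y => fderiv ℝ F y v) (planePoint z) := by
  obtain ⟨C, hC⟩ := exists_bound_indicator_fderiv hDb hU hDU hF v
  obtain ⟨B, hB⟩ := hDb.exists_norm_le
  have hmeas : Measurable fun z => D.indicator (fun y => fderiv ℝ F y v) (planePoint z) :=
    ((measurable_fderiv_apply_const ℝ F v).indicator hD.measurableSet).comp
      continuous_planePoint.measurable
  have hsupp : Function.support (fun z => D.indicator (fun y => fderiv ℝ F y v) (planePoint z)) ⊆
      Icc (-B) B ×ˢ Icc (-B) B := by
    intro z hz
    have hzD : planePoint z ∈ D := by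
      by_contra h
      exact hz (indicator_of_notMem h _)
    have h0 := (PiLp.norm_apply_le (planePoint z) 0).trans (hB _ hzD)
    have h1 := (PiLp.norm_apply_le (planePoint z) 1).trans (hB _ hzD)
    simp only [planePoint, basisE, PiLp.add_apply, PiLp.smul_apply, PiLp.single_apply,
      Real.norm_eq_abs] at h0 h1
    norm_num at h0 h1
    exact ⟨abs_le.1 h0, abs_le.1 h1⟩
  rw [← integrableOn_iff_integrable_of_support_subset hsupp]
  exact Measure.integrableOn_of_bounded
    (isCompact_Icc.prod isCompact_Icc).measure_lt_top.ne hmeas.aestronglyMeasurable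
    (Filter.Eventually.of_forall fun z => hC _)

/-- The integral over a bounded open set of a partial derivative of a function vanishing on the
boundary is zero. -/
lemma integral_indicator_fderiv_planePoint_eq_zero {D U : Set E2} {F : E2 → ℝ}
    (hD : IsOpen D) (hDb : Bornology.IsBounded D) (hU : IsOpen U) (hDU : closure D ⊆ U)
    (hcount : CountableOnAxisLines (frontier D))
    (hF : ContDiffOn ℝ 1 F U) (hF0 : ∀ x ∈ frontier D, F x = 0) (j : Fin 2) :
    ∫ z, D.indicator (fun y => fderiv ℝ F y (basisE j)) (planePoint z) = 0 := by
  have hint := integrable_indicator_fderiv_planePoint hD hDb hU hDU hF (basisE j)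
  have hline := fun x => integral_indicator_fderiv_line_eq_zero hD hDb hU hDU hF hF0 x
    (basisE j) (basisE_ne_zero j) (hcount j x)
  rw [Measure.volume_eq_prod] at hint ⊢
  fin_cases j
  · rw [integral_prod_symm _ hint]
    refine integral_eq_zero_of_ae (Filter.Eventually.of_forall fun t => ?_)
    simp only [planePoint, add_comm _ (t • basisE 1)]
    exact hline (t • basisE 1)
  · rw [integral_prod _ hint]
    exact integral_eq_zero_of_ae (Filter.Eventually.of_forall fun s => hline (s • basisE 0))

/-- Divergence theorem for a flux vanishing on the boundary: a nonnegative divergence is zero. -/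
lemma divergence_eq_zero_of_nonneg {D U : Set E2} {F : Fin 2 → E2 → ℝ}
    (hD : IsOpen D) (hDb : Bornology.IsBounded D) (hU : IsOpen U) (hDU : closure D ⊆ U)
    (hcount : CountableOnAxisLines (frontier D))
    (hF : ∀ j, ContDiffOn ℝ 1 (F j) U) (hF0 : ∀ j, ∀ x ∈ frontier D, F j x = 0)
    (hnn : ∀ x ∈ D, 0 ≤ ∑ j, fderiv ℝ (F j) x (basisE j)) :
    ∀ x ∈ D, ∑ j, fderiv ℝ (F j) x (basisE j) = 0 := by
  set w : E2 → ℝ := fun x => ∑ j, fderiv ℝ (F j) x (basisE j) with hw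
  have hwind : (fun z => D.indicator w (planePoint z)) = fun z =>
      ∑ j, D.indicator (fun y => fderiv ℝ (F j) y (basisE j)) (planePoint z) := by
    ext z
    by_cases hz : planePoint z ∈ D <;> simp [hz, hw]
  have hint : ∀ j ∈ Finset.univ, Integrable fun z =>
      D.indicator (fun y => fderiv ℝ (F j) y (basisE j)) (planePoint z) := fun j _ =>
    integrable_indicator_fderiv_planePoint hD hDb hU hDU (hF j) (basisE j)
  have hzero : ∫ z, D.indicator w (planePoint z) = 0 := by
    rw [hwind, integral_finsetSum _ hint]
    exact Finset.sum_eq_zero fun j _ =>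
      integral_indicator_fderiv_planePoint_eq_zero hD hDb hU hDU hcount (hF j) (hF0 j) j
  have hae := (integral_eq_zero_iff_of_nonneg (fun z => indicator_nonneg hnn (planePoint z))
    (hwind ▸ integrable_finsetSum _ hint)).1 hzero
  have hpre : IsOpen (planePoint ⁻¹' D) := hD.preimage continuous_planePoint
  have hwc : ContinuousOn w D := continuousOn_finsetSum _ fun j _ =>
    (((hF j).continuousOn_fderiv_of_isOpen hU le_rfl).mono
      (subset_closure.trans hDU)).clm_apply continuousOn_const
  have hwc' : ContinuousOn (fun z => D.indicator w (planePoint z)) (planePoint ⁻¹' D) :=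
    (hwc.comp continuous_planePoint.continuousOn fun z hz => hz).congr
      fun z hz => indicator_of_mem (s := D) hz _
  have heq := Measure.eqOn_open_of_ae_eq (ae_restrict_of_ae hae) hpre hwc' continuousOn_const
  intro x hx
  have hx' : planePoint (x 0, x 1) ∈ D := by rwa [planePoint_coords]
  have := heq hx'
  simpa [planePoint_coords, hx] using this

/-- A continuous linear map on the plane vanishes once it does on the standard basis. -/
lemma clm_eq_zero_of_basisE {G : Type*} [NormedAddCommGroup G] [NormedSpace ℝ G]
    {L : E2 →L[ℝ] G} (h : ∀ j, L (basisE j) = 0) : L = 0 := by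
  ext x
  rw [← planePoint_coords x]
  simp [planePoint, h]

/-- A stationary Stokes flow on a bounded domain with no-slip boundary is at rest. -/
lemma stokes_noslip_eq_zero {D U : Set E2} {u : E2 → E2} {p : E2 → ℝ} {ν : ℝ} (hν : 0 < ν)
    (hD : IsOpen D) (hDb : Bornology.IsBounded D) (hDc : IsPreconnected D)
    (hfr : (frontier D).Nonempty) (hU : IsOpen U) (hDU : closure D ⊆ U)
    (hcount : CountableOnAxisLines (frontier D))
    (hu : ContDiffOn ℝ 2 u U) (hp : ContDiffOn ℝ 1 p U)
    (hdiv : ∀ x ∈ D, divg u x = 0)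
    (hstokes : ∀ x ∈ D, ∀ i, ν * lap u x i = fderiv ℝ p x (basisE i))
    (hbc : ∀ x ∈ frontier D, u x = 0) :
    (∀ x ∈ closure D, u x = 0) ∧ (∀ x ∈ closure D, fderiv ℝ u x = 0) ∧
      ∃ c, ∀ x ∈ closure D, p x = c := by
  have hDU' : D ⊆ U := subset_closure.trans hDU
  have hui : ∀ i, ContDiffOn ℝ 2 (fun y => u y i) U := contDiffOn_euclidean.1 hu
  have hDu : ContDiffOn ℝ 1 (fderiv ℝ u) U := hu.fderiv_of_isOpen hU (by norm_num)
  have hdu : ∀ i j, ContDiffOn ℝ 1 (fun y => fderiv ℝ u y (basisE j) i) U := fun i j =>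
    contDiffOn_euclidean.1 (hDu.clm_apply contDiffOn_const) i
  set F : Fin 2 → E2 → ℝ := fun j y =>
    ν * ∑ i, u y i * fderiv ℝ u y (basisE j) i - p y * u y j with hFdef
  have hF : ∀ j, ContDiffOn ℝ 1 (F j) U := fun j =>
    (contDiffOn_const.mul (ContDiffOn.sum fun i _ =>
      ((hui i).of_le (by norm_num)).mul (hdu i j))).sub (hp.mul ((hui j).of_le (by norm_num)))
  have hF0 : ∀ j, ∀ x ∈ frontier D, F j x = 0 := fun j x hx => by simp [hFdef, hbc x hx]
  have hdivF : ∀ x ∈ D, ∑ j, fderiv ℝ (F j) x (basisE j) =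
      ν * ∑ j, ∑ i, (fderiv ℝ u x (basisE j) i) ^ 2 := by
    intro x hx
    have hxU := hU.mem_nhds (hDU' hx)
    have hud : HasFDerivAt u (fderiv ℝ u x) x :=
      ((hu.differentiableOn two_ne_zero).differentiableAt hxU).hasFDerivAt
    have huid : ∀ i, HasFDerivAt (fun y => u y i)
        ((EuclideanSpace.proj i).comp (fderiv ℝ u x)) x := fun i =>
      (EuclideanSpace.proj (𝕜 := ℝ) i).hasFDerivAt.comp x hud
    have hdud : ∀ i j, HasFDerivAt (fun y => fderiv ℝ u y (basisE j) i)
        (fderiv ℝ (fun y => fderiv ℝ u y (basisE j) i) x) x := fun i j =>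
      (((hdu i j).differentiableOn one_ne_zero).differentiableAt hxU).hasFDerivAt
    have hpd : HasFDerivAt p (fderiv ℝ p x) x :=
      ((hp.differentiableOn one_ne_zero).differentiableAt hxU).hasFDerivAt
    have hFd := fun j => (((HasFDerivAt.fun_sum fun i (_ : i ∈ Finset.univ) =>
      (huid i).mul (hdud i j)).const_mul ν).sub (hpd.mul (huid j))).fderiv
    have h0 := hdiv x hx
    have h1 := hstokes x hx 0
    have h2 := hstokes x hx 1
    have hFd0 : fderiv ℝ (F 0) x = _ := hFd 0
    have hFd1 : fderiv ℝ (F 1) x = _ := hFd 1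
    simp only [divg, lap, Fin.sum_univ_two] at h0 h1 h2
    rw [Fin.sum_univ_two, hFd0, hFd1]
    simp only [Fin.sum_univ_two, _root_.sub_apply, _root_.add_apply,
      _root_.smul_apply, ContinuousLinearMap.comp_apply, PiLp.proj_apply,
      smul_eq_mul]
    linear_combination u x 0 * h1 + u x 1 * h2 - p x * h0
  have hzero := divergence_eq_zero_of_nonneg hD hDb hU hDU hcount hF hF0 fun x hx => by
    rw [hdivF x hx]; positivity
  have hDu0 : ∀ x ∈ D, fderiv ℝ u x = 0 := by
    intro x hx
    have h := hzero x hx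
    rw [hdivF x hx, mul_eq_zero, or_iff_right hν.ne',
      Finset.sum_eq_zero_iff_of_nonneg fun j _ => by positivity] at h
    refine clm_eq_zero_of_basisE fun j => ?_
    have hj := h j (Finset.mem_univ j)
    rw [Finset.sum_eq_zero_iff_of_nonneg fun i _ => by positivity] at hj
    ext i
    simpa using hj i (Finset.mem_univ i)
  obtain ⟨a, ha⟩ := hD.exists_is_const_of_fderiv_eq_zero hDc
    ((hu.differentiableOn two_ne_zero).mono hDU') hDu0
  have ha' : EqOn u (fun _ => a) (closure D) :=
    EqOn.of_subset_closure ha (hu.continuousOn.mono hDU) continuousOn_const subset_closure le_rfl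
  have hu0 : ∀ x ∈ closure D, u x = 0 := by
    obtain ⟨y, hy⟩ := hfr
    have : a = 0 := (ha' (frontier_subset_closure hy)).symm.trans (hbc y hy)
    exact fun x hx => (ha' hx).trans this
  have hDu0' : EqOn (fderiv ℝ u) (fun _ => 0) (closure D) :=
    EqOn.of_subset_closure hDu0 (hDu.continuousOn.mono hDU) continuousOn_const subset_closure le_rfl
  have hp0 : EqOn (fderiv ℝ p) 0 D := by
    intro x hx
    refine clm_eq_zero_of_basisE fun i => ?_
    rw [← hstokes x hx i]
    have hev : ∀ j, (fun y => fderiv ℝ u y (basisE j) i) =ᶠ[𝓝 x] fun _ => 0 := fun j => by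
      filter_upwards [hD.mem_nhds hx] with y hy
      simp [hDu0 y hy]
    simp [lap, (hev _).fderiv_eq]
  obtain ⟨c, hc⟩ := hD.exists_is_const_of_fderiv_eq_zero hDc
    ((hp.differentiableOn one_ne_zero).mono hDU') hp0
  exact ⟨hu0, hDu0', c, EqOn.of_subset_closure hc (hp.continuousOn.mono hDU) continuousOn_const
    subset_closure le_rfl⟩

lemma countableOnAxisLines_sphere (r : ℝ) : CountableOnAxisLines {x : E2 | ‖x‖ = r} := by
  intro j x
  have key : ∀ k : Fin 2, ∀ c : ℝ, {t : ℝ | (x k + t) ^ 2 = c}.Countable := fun k c => by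
    refine (Set.toFinite {√c - x k, -√c - x k}).countable.mono fun t ht => ?_
    have ht' : (x k + t) ^ 2 = √c ^ 2 := by
      rw [Real.sq_sqrt (by rw [← ht.out]; positivity), ht.out]
    rcases sq_eq_sq_iff_eq_or_eq_neg.1 ht' with h | h
    · left; linarith
    · right; rw [mem_singleton_iff]; linarith
  fin_cases j
  · refine (key 0 (r ^ 2 - x 1 ^ 2)).mono fun t ht => ?_
    rw [mem_ofPred_eq, ← ht.out, EuclideanSpace.real_norm_sq_eq]
    simp [basisE, Fin.sum_univ_two]
  · refine (key 1 (r ^ 2 - x 0 ^ 2)).mono fun t ht => ?_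
    rw [mem_ofPred_eq, ← ht.out, EuclideanSpace.real_norm_sq_eq]
    simp [basisE, Fin.sum_univ_two]

lemma CountableOnAxisLines.mono {S T : Set E2} (hT : CountableOnAxisLines T) (h : S ⊆ T) :
    CountableOnAxisLines S := fun j x => (hT j x).mono fun _ ht => h ht

lemma CountableOnAxisLines.union {S T : Set E2} (hS : CountableOnAxisLines S)
    (hT : CountableOnAxisLines T) : CountableOnAxisLines (S ∪ T) := fun j x =>
  (hS j x).union (hT j x)

section Annulus

lemma isOpen_annulus {E : Type*} [NormedAddCommGroup E] {a b : ℝ} :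
    IsOpen {x : E | a < ‖x‖ ∧ ‖x‖ < b} :=
  (isOpen_lt continuous_const continuous_norm).inter (isOpen_lt continuous_norm continuous_const)

variable {E : Type*} [NormedAddCommGroup E] [NormedSpace ℝ E] {a b : ℝ}

lemma closure_annulus (ha : 0 < a) (hab : a < b) :
    closure {x : E | a < ‖x‖ ∧ ‖x‖ < b} = {x : E | a ≤ ‖x‖ ∧ ‖x‖ ≤ b} := by
  refine subset_antisymm (closure_minimal (fun x hx => ⟨hx.1.le, hx.2.le⟩) ?_) fun x hx => ?_
  · exact (isClosed_le continuous_const continuous_norm).inter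
      (isClosed_le continuous_norm continuous_const)
  · have hx0 : ‖x‖ ≠ 0 := (ha.trans_le hx.1).ne'
    have hmaps : MapsTo (fun t : ℝ => t • ‖x‖⁻¹ • x) (Ioo a b) {x : E | a < ‖x‖ ∧ ‖x‖ < b} := by
      intro t ht
      have : ‖t • ‖x‖⁻¹ • x‖ = t := by
        rw [norm_smul, norm_smul, norm_inv, norm_norm, inv_mul_cancel₀ hx0, mul_one,
          Real.norm_of_nonneg (ha.trans ht.1).le]
      simpa [this] using ht
    have hmem : ‖x‖ ∈ closure (Ioo a b) := by rwa [closure_Ioo hab.ne]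
    have h := hmaps.closure (by fun_prop) hmem
    simpa [smul_smul, mul_inv_cancel₀ hx0] using h

lemma isPreconnected_annulus (hE : 1 < Module.rank ℝ E) (ha : 0 ≤ a) :
    IsPreconnected {x : E | a < ‖x‖ ∧ ‖x‖ < b} := by
  have h := ((isPreconnected_Ioo (a := a) (b := b)).prod (isPreconnected_sphere hE 0 1)).image
    (fun q : ℝ × E => q.1 • q.2) (by fun_prop)
  convert h using 1
  ext x
  constructor
  · intro hx
    have hx0 : ‖x‖ ≠ 0 := (ha.trans_lt hx.1).ne'
    refine ⟨(‖x‖, ‖x‖⁻¹ • x), ⟨hx, ?_⟩, ?_⟩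
    · simp [norm_smul, hx0]
    · simp [smul_smul, hx0]
  · rintro ⟨⟨t, y⟩, ⟨ht, hy⟩, rfl⟩
    have hy' : ‖y‖ = 1 := by simpa using hy
    simpa [norm_smul, hy', abs_of_pos (ha.trans_lt ht.1)] using ht

lemma frontier_annulus (ha : 0 < a) (hab : a < b) :
    frontier {x : E | a < ‖x‖ ∧ ‖x‖ < b} = {x : E | ‖x‖ = a} ∪ {x : E | ‖x‖ = b} := by
  rw [isOpen_annulus.frontier_eq, closure_annulus ha hab]
  ext x
  simp only [mem_sdiff, mem_ofPred_eq, mem_union, not_and_or, not_lt]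
  grind

end Annulus

/-- Characterization of the stationary state (first part of Lemma 1) in the ball/annulus
geometry: a stationary Stokes transmission solution with zero interface and outer-boundary
velocity has zero velocity, constant pressures, and normal-stress jump `c·n` on the circle. -/
theorem stationary_state_characterization (R ν : ℝ) (hR : 1 < R) (hν : 0 < ν)
    (um up : E2 → E2) (pm pp : E2 → ℝ)
    (Um Up : Set E2) (hUmo : IsOpen Um) (hUpo : IsOpen Up)
    (hUm_sub : Metric.closedBall (0 : E2) 1 ⊆ Um)
    (hUp_sub : {x : E2 | 1 ≤ ‖x‖ ∧ ‖x‖ ≤ R} ⊆ Up)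
    (hum : ContDiffOn ℝ 2 um Um) (hpm : ContDiffOn ℝ 1 pm Um)
    (hup : ContDiffOn ℝ 2 up Up) (hpp : ContDiffOn ℝ 1 pp Up)
    (hdivm : ∀ x ∈ Metric.ball (0 : E2) 1, divg um x = 0)
    (hstokesm : ∀ x ∈ Metric.ball (0 : E2) 1, ∀ i, ν * lap um x i = fderiv ℝ pm x (basisE i))
    (hdivp : ∀ x ∈ {x : E2 | 1 < ‖x‖ ∧ ‖x‖ < R}, divg up x = 0)
    (hstokesp : ∀ x ∈ {x : E2 | 1 < ‖x‖ ∧ ‖x‖ < R}, ∀ i,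
      ν * lap up x i = fderiv ℝ pp x (basisE i))
    (hbcR : ∀ x : E2, ‖x‖ = R → up x = 0)
    (hbc1p : ∀ x : E2, ‖x‖ = 1 → up x = 0)
    (hbc1m : ∀ x : E2, ‖x‖ = 1 → um x = 0) :
    (∀ x ∈ {x : E2 | 1 ≤ ‖x‖ ∧ ‖x‖ ≤ R}, up x = 0) ∧
    (∀ x ∈ Metric.closedBall (0 : E2) 1, um x = 0) ∧
    (∃ cp : ℝ, ∀ x ∈ {x : E2 | 1 ≤ ‖x‖ ∧ ‖x‖ ≤ R}, pp x = cp) ∧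
    (∃ cm : ℝ, ∀ x ∈ Metric.closedBall (0 : E2) 1, pm x = cm) ∧
    (∃ c : ℝ, ∀ x : E2, ‖x‖ = 1 → ∀ i,
      ((stress ν up pp x - stress ν um pm x).mulVec (fun j => x j)) i = c * x i) := by
  have hB1 : (1 : ℝ) ≠ 0 := one_ne_zero
  have hnorm : ‖basisE 0‖ = 1 := by simp [basisE]
  have hrank : 1 < Module.rank ℝ E2 := by
    rw [← Module.finrank_eq_rank, finrank_euclideanSpace_fin]; norm_num
  have hclm : closure (Metric.ball (0 : E2) 1) = Metric.closedBall 0 1 := closure_ball _ hB1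
  have hfrm : frontier (Metric.ball (0 : E2) 1) = {x | ‖x‖ = 1} := by
    rw [frontier_ball _ hB1]; ext x; simp
  have hclp := closure_annulus (E := E2) one_pos hR
  have hfrp := frontier_annulus (E := E2) one_pos hR
  obtain ⟨hum0, hDum, cm, hcm⟩ := stokes_noslip_eq_zero hν Metric.isOpen_ball Metric.isBounded_ball
    (convex_ball _ _).isPreconnected (hfrm ▸ ⟨basisE 0, hnorm⟩) hUmo (hclm ▸ hUm_sub)
    (hfrm ▸ countableOnAxisLines_sphere 1) hum hpm hdivm hstokesm
    (fun x hx => hbc1m x (hfrm ▸ hx : x ∈ {x : E2 | ‖x‖ = 1}))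
  obtain ⟨hup0, hDup, cp, hcp⟩ := stokes_noslip_eq_zero hν isOpen_annulus
    (Metric.isBounded_ball.subset fun x hx => mem_ball_zero_iff.2 hx.2)
    (isPreconnected_annulus hrank zero_le_one) (hfrp ▸ ⟨basisE 0, Or.inl hnorm⟩) hUpo
    (hclp ▸ hUp_sub)
    (hfrp ▸ (countableOnAxisLines_sphere 1).union (countableOnAxisLines_sphere R))
    hup hpp hdivp hstokesp fun x hx => by
      rw [hfrp] at hx
      exact hx.elim (hbc1p x) (hbcR x)
  rw [hclm] at hum0 hDum hcm
  rw [hclp] at hup0 hDup hcp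
  refine ⟨hup0, hum0, ⟨cp, hcp⟩, ⟨cm, hcm⟩, cm - cp, fun x hx i => ?_⟩
  have hxm : x ∈ Metric.closedBall (0 : E2) 1 := mem_closedBall_zero_iff.2 hx.le
  have hxp : x ∈ {x : E2 | 1 ≤ ‖x‖ ∧ ‖x‖ ≤ R} := ⟨hx.ge, hx.trans_le hR.le⟩
  have hsym : ∀ u : E2 → E2, fderiv ℝ u x = 0 → symGrad u x = 0 := fun u hu => by
    ext k l
    simp [symGrad, jacMat, hu]
  rw [stress, stress, hsym up (hDup x hxp), hsym um (hDum x hxm), hcp x hxp, hcm x hxm]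
  simp only [smul_zero, zero_sub, sub_neg_eq_add, Matrix.add_mulVec, Matrix.neg_mulVec,
    Matrix.smul_mulVec, Matrix.one_mulVec, Pi.add_apply, Pi.neg_apply, Pi.smul_apply, smul_eq_mul]
  ring
end
end
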